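/- Assume Λ ⊆ ℂ is a compact q-invariant set on which q is uniformly expanding, and let A = g(Λ). Then there exists ε₀ > 0 such that for every b ∈ ℂ with 0 < |b| < ε₀ there exist a compact H_b-invariant set A_b ⊆ ℂ² which is a uniformly hyperbolic set for the diffeomorphism H_b, and a homeomorphism Φ_b : Σ(A, H₀) → A_b satisfying Φ_b ∘ σ = H_b ∘ Φ_b, i.e. the shift on Σ(A, H₀) is topologically conjugate to H_b restricted to A_b. -/

import Mathlib

noncomputable section
open Set Metric Topology Filter ENNReal

/-- The quadratic map `q(x) = x² + c`. -/
def qmap (c : ℂ) : ℂ → ℂ := fun x => x ^ 2 + c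

/-- The Hénon map `H_b(x,y) = (x² + c − b·y, x)`; `H₀(x,y) = (q(x), x)`. -/
def henon (c b : ℂ) : ℂ × ℂ → ℂ × ℂ := fun p => (p.1 ^ 2 + c - b * p.2, p.1)

/-- `g(x) = (q(x), x)`. -/
def gmap (c : ℂ) : ℂ → ℂ × ℂ := fun x => (qmap c x, x)

/-- A set `S` is invariant under `f` if `f⁻¹(S) = S`. -/
def Invariant {α : Type*} (f : α → α) (S : Set α) : Prop := f ⁻¹' S = S

/-- `Σ(S, f)`: bi-infinite orbit sequences of `f` lying in `S`, topologized as a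
subspace of the product space `ℤ → X`. -/
def SigmaSet {X : Type*} (f : X → X) (S : Set X) : Set (ℤ → X) :=
  {z | (∀ i, z i ∈ S) ∧ ∀ i, f (z i) = z (i + 1)}

/-- The shift on bi-infinite sequences. -/
def shiftSeq {X : Type*} (z : ℤ → X) : ℤ → X := fun i => z (i + 1)

lemma shiftSeq_mem {X : Type*} {f : X → X} {S : Set X} {z : ℤ → X}
    (hz : z ∈ SigmaSet f S) : shiftSeq z ∈ SigmaSet f S :=
  ⟨fun i => hz.1 (i + 1), fun i => hz.2 (i + 1)⟩

/-- The shift map `σ` as a self-map of `Σ(S, f)`. -/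
def sigmaShift {X : Type*} (f : X → X) (S : Set X) :
    (SigmaSet f S) → (SigmaSet f S) :=
  fun z => ⟨shiftSeq z.1, shiftSeq_mem z.2⟩

/-- The inverse of the Hénon map (for `b ≠ 0`). -/
def henonInv (c b : ℂ) : ℂ × ℂ → ℂ × ℂ := fun p => (p.2, (p.2 ^ 2 + c - p.1) / b)

/-- `K(f)`: points with bounded forward orbit. -/
def Kset {E : Type*} [NormedAddCommGroup E] (f : E → E) : Set E :=
  {z | ∃ R : ℝ, ∀ n : ℕ, ‖f^[n] z‖ ≤ R}

/-- `J(f) = ∂K(f)`. -/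
def Jset {E : Type*} [NormedAddCommGroup E] (f : E → E) : Set E := frontier (Kset f)

/-- The Julia set `J(H_b) = J⁺(H_b) ∩ J⁻(H_b)` of the Hénon map. -/
def henonJulia (c b : ℂ) : Set (ℂ × ℂ) := Jset (henon c b) ∩ Jset (henonInv c b)

/-- A set `S` is uniformly expanding for `f : ℂ → ℂ`:
`∃ C > 0, λ > 1` with `|D(fⁿ)(z)| ≥ C·λⁿ` for all `z ∈ S`, `n ≥ 1`. -/
def IsExpandingOn (f : ℂ → ℂ) (S : Set ℂ) : Prop :=
  ∃ C > 0, ∃ lam > 1, ∀ z ∈ S, ∀ n : ℕ, 1 ≤ n → C * lam ^ n ≤ ‖deriv (f^[n]) z‖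

/-- Uniform hyperbolicity of a compact invariant set of a diffeomorphism `f`
(with inverse `finv`): a splitting `ℂ^k = Eˢ_z ⊕ Eᵘ_z` varying continuously with
`z` (encoded by the projection `P z` onto `Eˢ_z` along `Eᵘ_z`), invariant under
`Df`, with uniform contraction rates `(λ_s, λ_u)` on `Eˢ` under forward iterates
and on `Eᵘ` under backward iterates. -/
def IsHyperbolicSet {E : Type*} [NormedAddCommGroup E] [NormedSpace ℂ E]
    (f finv : E → E) (S : Set E) : Prop :=
  ∃ (Es Eu : E → Submodule ℂ E) (P : E → E →L[ℂ] E) (Cs Cu lams lamu : ℝ),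
    0 < Cs ∧ 0 < Cu ∧ 0 < lams ∧ lams < 1 ∧ 1 < lamu ∧
    ContinuousOn P S ∧
    (∀ z ∈ S, ∀ v : E, P z v ∈ Es z ∧ v - P z v ∈ Eu z) ∧
    (∀ z ∈ S, ∀ v ∈ Es z, P z v = v) ∧
    (∀ z ∈ S, ∀ v ∈ Eu z, P z v = 0) ∧
    (∀ z ∈ S, (Es z).map (fderiv ℂ f z).toLinearMap = Es (f z)) ∧
    (∀ z ∈ S, (Eu z).map (fderiv ℂ f z).toLinearMap = Eu (f z)) ∧
    (∀ z ∈ S, ∀ n : ℕ, 1 ≤ n → ∀ v ∈ Es z, ‖fderiv ℂ (f^[n]) z v‖ ≤ Cs * lams ^ n * ‖v‖) ∧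
    (∀ z ∈ S, ∀ n : ℕ, 1 ≤ n → ∀ v ∈ Eu z, ‖fderiv ℂ (finv^[n]) z v‖ ≤ Cu * (lamu ^ n)⁻¹ * ‖v‖)

theorem exists_weight_of_isExpandingOn {c : ℂ} {Λ : Set ℂ} (hcomp : IsCompact Λ)
    (hexp : IsExpandingOn (qmap c) Λ) :
    ∃ (ρ : ℂ → ℝ) (μ K : ℝ), Continuous ρ ∧ 1 < μ ∧ (∀ z, 1 ≤ ρ z) ∧ (∀ z ∈ Λ, ρ z ≤ K) ∧
      ∀ z ∈ Λ, μ * ρ z ≤ ‖2 * z‖ * ρ (qmap c z) := by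
  obtain ⟨C, hC, lam, hlam, hD⟩ := hexp
  have hq : ∀ z, HasDerivAt (qmap c) (2 * z) z := fun z => by
    change HasDerivAt (fun x => x ^ 2 + c) (2 * z) z
    simpa using (hasDerivAt_pow 2 z).add_const c
  have hqd : Differentiable ℂ (qmap c) := fun z => (hq z).differentiableAt
  have hsucc : ∀ k z, deriv ((qmap c)^[k + 1]) z = deriv ((qmap c)^[k]) (qmap c z) * (2 * z) := by
    intro k z
    rw [Function.iterate_succ]
    exact (((hqd.iterate k) (qmap c z)).hasDerivAt.comp z (hq z)).deriv
  have hcont : ∀ k, Continuous (deriv ((qmap c)^[k])) := by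
    intro k
    induction k with
    | zero => simpa using continuous_const
    | succ k ih =>
      rw [funext (hsucc k)]
      exact (ih.comp hqd.continuous).mul (by fun_prop)
  obtain ⟨μ, hμ1, hμ2⟩ := exists_between hlam
  have hμ0 : 0 < μ := by linarith
  obtain ⟨n, hn⟩ := pow_unbounded_of_one_lt (1 / C) ((one_lt_div hμ0).2 hμ2)
  have hN : μ ^ (n + 1) ≤ C * lam ^ (n + 1) := by
    have h1 : 1 / C < (lam / μ) ^ (n + 1) :=
      hn.trans_le (pow_le_pow_right₀ ((one_lt_div hμ0).2 hμ2).le n.le_succ)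
    rw [div_pow, div_lt_div_iff₀ hC (by positivity)] at h1
    linarith
  let ρ : ℂ → ℝ := fun z => ∑ k ∈ Finset.range (n + 1), ‖deriv ((qmap c)^[k]) z‖ * μ⁻¹ ^ k
  have hρ : Continuous ρ :=
    continuous_finsetSum _ fun k _ => ((hcont k).norm.mul continuous_const)
  have hρ1 : ∀ z, 1 ≤ ρ z := fun z => by
    have h := Finset.single_le_sum (f := fun k => ‖deriv ((qmap c)^[k]) z‖ * μ⁻¹ ^ k)
      (fun i _ => by positivity) (Finset.mem_range.2 n.succ_pos)
    simpa [ρ] using h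
  obtain ⟨K, hK⟩ := hcomp.exists_bound_of_continuousOn hρ.continuousOn
  refine ⟨ρ, μ, K, hρ, hμ1, hρ1, fun z hz => (le_abs_self _).trans (hK z hz), fun z hz => ?_⟩
  have key : ‖2 * z‖ * ρ (qmap c z)
      = μ * ∑ k ∈ Finset.range (n + 1), ‖deriv ((qmap c)^[k + 1]) z‖ * μ⁻¹ ^ (k + 1) := by
    simp only [ρ, Finset.mul_sum]
    refine Finset.sum_congr rfl fun k _ => ?_
    rw [hsucc, norm_mul (deriv _ _), pow_succ]
    generalize ‖2 * z‖ = s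
    field_simp
  rw [key]
  gcongr
  have h1 := Finset.sum_range_succ (fun k => ‖deriv ((qmap c)^[k]) z‖ * μ⁻¹ ^ k) (n + 1)
  have h2 := Finset.sum_range_succ' (fun k => ‖deriv ((qmap c)^[k]) z‖ * μ⁻¹ ^ k) (n + 1)
  have h3 : 1 ≤ ‖deriv ((qmap c)^[n + 1]) z‖ * μ⁻¹ ^ (n + 1) := by
    have h4 := hN.trans (hD z hz (n + 1) (by omega))
    rw [inv_pow, ← div_eq_mul_inv, one_le_div (by positivity)]
    exact h4
  simp only [Function.iterate_zero, deriv_id', norm_one, pow_zero, mul_one] at h2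
  simp only [ρ]
  linarith

/-- A contraction principle for self-maps of the continuous functions bounded by `r`. -/
theorem exists_continuous_fixedPoint {X : Type*} [TopologicalSpace X] [CompactSpace X]
    (T : (X → ℂ) → X → ℂ) {r κ : ℝ} (hr : 0 ≤ r) (hκ : κ < 1)
    (hcont : ∀ u, Continuous u → (∀ x, ‖u x‖ ≤ r) → Continuous (T u))
    (hmaps : ∀ u, Continuous u → (∀ x, ‖u x‖ ≤ r) → ∀ x, ‖T u x‖ ≤ r)
    (hlip : ∀ u v : X → ℂ, (∀ x, ‖u x‖ ≤ r) → (∀ x, ‖v x‖ ≤ r) →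
      ∀ D, 0 ≤ D → (∀ x, ‖u x - v x‖ ≤ D) → ∀ x, ‖T u x - T v x‖ ≤ κ * D) :
    ∃ u : X → ℂ, Continuous u ∧ (∀ x, ‖u x‖ ≤ r) ∧ ∀ x, T u x = u x := by
  let S := closedBall (0 : C(X, ℂ)) r
  have hS : ∀ u : S, ∀ x, ‖u.1 x‖ ≤ r := fun u x =>
    (u.1.norm_coe_le_norm x).trans (mem_closedBall_zero_iff.1 u.2)
  let F : S → S := fun u => ⟨⟨T u.1, hcont _ u.1.continuous (hS u)⟩,
    mem_closedBall_zero_iff.2 <| (ContinuousMap.norm_le _ hr).2 (hmaps _ u.1.continuous (hS u))⟩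
  have hF : ContractingWith κ.toNNReal F := by
    refine ⟨by simpa using hκ, LipschitzWith.of_dist_le_mul fun u v => ?_⟩
    rw [Subtype.dist_eq]
    refine (ContinuousMap.dist_le (by positivity)).2 fun x => ?_
    rw [dist_eq_norm]
    refine (hlip u.1 v.1 (hS u) (hS v) (dist u v) dist_nonneg (fun y => ?_) x).trans ?_
    · rw [← dist_eq_norm]
      exact ContinuousMap.dist_apply_le_dist y
    · gcongr
      exact Real.le_coe_toNNReal κ
  have : CompleteSpace S := isClosed_closedBall.completeSpace_coe
  have : Nonempty S := ⟨⟨0, by simpa [S] using hr⟩⟩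
  refine ⟨(ContractingWith.fixedPoint F hF).1, (ContractingWith.fixedPoint F hF).1.continuous,
    hS _, fun x => ?_⟩
  have h := hF.fixedPoint_isFixedPt
  exact congrArg (fun u : S => u.1 x) h

theorem exists_continuous_slope {X : Type*} [TopologicalSpace X] [CompactSpace X]
    {φ : X → X} (hφ : Continuous φ) {a : X → ℂ} (ha : Continuous a) {b : ℂ} {δ : ℝ} (hδ : 0 < δ)
    (haδ : ∀ x, 2 * δ ≤ ‖a x‖) (hb : ‖b‖ ≤ δ ^ 2 / 2) :
    ∃ k : X → ℂ, Continuous k ∧ (∀ x, ‖k x‖ ≤ δ⁻¹) ∧ ∀ x, k x * (a x - b * k (φ x)) = 1 := by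
  have hden : ∀ (t : ℂ) (x : X), ‖t‖ ≤ δ⁻¹ → δ ≤ ‖a x - b * t‖ := by
    intro t x ht
    have h1 : ‖b * t‖ ≤ δ ^ 2 / 2 * δ⁻¹ := by
      rw [norm_mul]; gcongr
    have h2 : δ ^ 2 / 2 * δ⁻¹ = δ / 2 := by field_simp
    have h3 := norm_sub_norm_le (a x) (b * t)
    linarith [haδ x]
  have hne : ∀ (t : ℂ) (x : X), ‖t‖ ≤ δ⁻¹ → a x - b * t ≠ 0 := fun t x ht =>
    norm_pos_iff.1 (hδ.trans_le (hden t x ht))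
  obtain ⟨k, hk, hkδ, hfix⟩ := exists_continuous_fixedPoint
    (fun u x => (a x - b * u (φ x))⁻¹) (inv_nonneg.2 hδ.le) (κ := 1 / 2) (by norm_num)
    (fun u hu hur => (by fun_prop : Continuous fun x => a x - b * u (φ x)).inv₀
      fun x => hne _ x (hur _))
    (fun u hu hur x => by
      rw [norm_inv]
      exact inv_anti₀ hδ (hden _ x (hur _)))
    (fun u v hu hv D hD0 hD x => by
      have h1 := hne _ x (hu (φ x))
      have h2 := hne _ x (hv (φ x))
      rw [inv_sub_inv h1 h2, norm_div, norm_mul, div_le_iff₀ (by positivity)]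
      have h3 : a x - b * v (φ x) - (a x - b * u (φ x)) = b * (u (φ x) - v (φ x)) := by ring
      rw [h3, norm_mul]
      calc ‖b‖ * ‖u (φ x) - v (φ x)‖ ≤ δ ^ 2 / 2 * D := by gcongr; exact hD _
        _ = 1 / 2 * D * (δ * δ) := by ring
        _ ≤ _ := by
          gcongr
          exacts [hden _ x (hu _), hden _ x (hv _)])
  refine ⟨k, hk, hkδ, fun x => ?_⟩
  nth_rewrite 1 [← hfix x]
  exact inv_mul_cancel₀ (hne _ x (hkδ _))

theorem exists_shadowing {X : Type*} [TopologicalSpace X] [CompactSpace X] (τ : X ≃ₜ X)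
    {p : X → ℂ} {g : X → ℝ} {b c : ℂ} {μ K B r : ℝ} (hp : Continuous p) (hg : Continuous g)
    (hpτ : ∀ x, p (τ x) = p x ^ 2 + c) (hpB : ∀ x, ‖p x‖ ≤ B)
    (hμ : 1 < μ) (hg1 : ∀ x, 1 ≤ g x) (hgK : ∀ x, g x ≤ K)
    (hexp : ∀ x, μ * g x ≤ ‖2 * p x‖ * g (τ x)) (hr : 0 ≤ r)
    (hmaps : μ⁻¹ * r + K ^ 2 * (r ^ 2 + ‖b‖ * (B + r)) ≤ r)
    (hlip : μ⁻¹ + K ^ 2 * (2 * r + ‖b‖) < 1) :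
    ∃ h : X → ℂ, Continuous h ∧ (∀ x, ‖h x - p x‖ ≤ r) ∧
      ∀ x, h (τ x) = h x ^ 2 + c - b * h (τ.symm x) := by
  have hμ0 : 0 < μ := by linarith
  have hg0 : ∀ x, 0 < g x := fun x => by linarith [hg1 x]
  have hgne : ∀ x, (g x : ℂ) ≠ 0 := fun x => by exact_mod_cast (hg0 x).ne'
  have hp0 : ∀ x, 2 * p x ≠ 0 := fun x h0 => by
    have := hexp x
    rw [h0, norm_zero, zero_mul] at this
    nlinarith [hg0 x]
  let e : X → ℂ := fun x => g x / (2 * p x)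
  have he : Continuous e := by
    refine Continuous.div (by fun_prop) (by fun_prop) hp0
  have he1 : ∀ x, ‖e x / g (τ x)‖ ≤ μ⁻¹ := fun x => by
    simp only [e]
    rw [norm_div, norm_div, Complex.norm_of_nonneg (hg0 _).le, Complex.norm_of_nonneg (hg0 _).le,
      div_div, inv_eq_one_div, div_le_div_iff₀ (mul_pos (norm_pos_iff.2 (hp0 x)) (hg0 _)) hμ0]
    linarith [hexp x]
  have he2 : ∀ x, ‖e x‖ ≤ K := fun x => by
    have h1 : e x = e x / g (τ x) * g (τ x) := by rw [div_mul_cancel₀ _ (hgne _)]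
    rw [h1, norm_mul, Complex.norm_of_nonneg (hg0 _).le]
    calc _ ≤ μ⁻¹ * K := mul_le_mul (he1 x) (hgK _) (hg0 _).le (by positivity)
      _ ≤ 1 * K := by
        gcongr
        · linarith [hg1 x, hgK x]
        · exact inv_le_one_of_one_le₀ hμ.le
      _ = K := one_mul K
  have hu : ∀ (t : ℂ) (x : X), ‖t / g x‖ ≤ ‖t‖ := fun t x => by
    rw [norm_div, Complex.norm_of_nonneg (hg0 _).le]
    exact div_le_self (norm_nonneg _) (hg1 x)
  by_cases hX : Nonempty X
  swap
  · exact ⟨p, hp, fun x => (hX ⟨x⟩).elim, fun x => (hX ⟨x⟩).elim⟩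
  obtain ⟨x₀⟩ := hX
  have hK1 : 1 ≤ K := (hg1 x₀).trans (hgK x₀)
  have hB0 : 0 ≤ B := (norm_nonneg _).trans (hpB x₀)
  have hKK : K ≤ K ^ 2 := by nlinarith
  obtain ⟨v, hv, hvr, hfix⟩ := exists_continuous_fixedPoint
    (fun v x => e x / g (τ x) * v (τ x)
      + e x * (b * (p (τ.symm x) + v (τ.symm x) / g (τ.symm x)) - (v x / g x) ^ 2)) hr hlip
    (fun v hv _ => by
      have h1 : Continuous fun x => v x / g x := hv.div (by fun_prop) hgne
      have h2 : Continuous fun x => e x / g (τ x) := he.div (by fun_prop) fun x => hgne _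
      have h3 : Continuous fun x => v (τ.symm x) / g (τ.symm x) := h1.comp τ.symm.continuous
      fun_prop)
    (fun v hv hvr x => by
      refine le_trans (norm_add_le _ _) (le_trans ?_ hmaps)
      rw [norm_mul, norm_mul]
      gcongr
      · exact he1 x
      · exact hvr _
      · exact (he2 x).trans hKK
      · refine (norm_sub_le _ _).trans ?_
        rw [add_comm, norm_pow, norm_mul]
        gcongr
        · exact (hu _ _).trans (hvr _)
        · refine (norm_add_le _ _).trans (add_le_add (hpB _) ((hu _ _).trans (hvr _))))
    (fun v w hvr hwr D hD0 hD x => by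
      have h1 : ∀ y, ‖v y / g y - w y / g y‖ ≤ D := fun y => by
        rw [← sub_div]; exact (hu _ _).trans (hD y)
      have h2 : ‖v x / g x + w x / g x‖ ≤ 2 * r := by
        refine (norm_add_le _ _).trans ?_
        linarith [(hu (v x) x).trans (hvr x), (hu (w x) x).trans (hwr x)]
      have h3 : (e x / g (τ x) * v (τ x)
            + e x * (b * (p (τ.symm x) + v (τ.symm x) / g (τ.symm x)) - (v x / g x) ^ 2))
          - (e x / g (τ x) * w (τ x)
            + e x * (b * (p (τ.symm x) + w (τ.symm x) / g (τ.symm x)) - (w x / g x) ^ 2))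
          = e x / g (τ x) * (v (τ x) - w (τ x))
            + e x * (b * (v (τ.symm x) / g (τ.symm x) - w (τ.symm x) / g (τ.symm x))
              - (v x / g x + w x / g x) * (v x / g x - w x / g x)) := by ring
      have h4 : (μ⁻¹ + K ^ 2 * (2 * r + ‖b‖)) * D
          = μ⁻¹ * D + K ^ 2 * (‖b‖ * D + 2 * r * D) := by ring
      rw [h3, h4]
      refine (norm_add_le _ _).trans ?_
      rw [norm_mul, norm_mul]
      gcongr
      · exact he1 x
      · exact hD _
      · exact (he2 x).trans hKK
      · refine (norm_sub_le _ _).trans ?_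
        rw [norm_mul, norm_mul]
        gcongr
        · exact h1 _
        · exact h1 _)
  refine ⟨fun x => p x + v x / g x, ?_, fun x => ?_, fun x => ?_⟩
  · exact hp.add (hv.div (by fun_prop) hgne)
  · rw [add_sub_cancel_left]
    exact (hu _ _).trans (hvr x)
  · have h1 := hfix x
    simp only [e] at h1
    have h2 := hgne x
    have h3 := hgne (τ x)
    have h4 := hp0 x
    have h5 : v (τ x) / g (τ x) + (b * (p (τ.symm x) + v (τ.symm x) / g (τ.symm x))
        - (v x / g x) ^ 2) = 2 * p x * (v x / g x) := by
      generalize b * (p (τ.symm x) + v (τ.symm x) / g (τ.symm x)) - (v x / g x) ^ 2 = s at h1 ⊢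
      generalize 2 * p x = P at h1 h4 ⊢
      rw [← h1]
      field_simp
    simp only
    rw [hpτ]
    linear_combination h5

theorem eq_of_forall_norm_sub_le {X : Type*} {τ : X → X} {p : X → ℂ} {g : X → ℝ} {c : ℂ}
    {μ K r : ℝ} (hpτ : ∀ x, p (τ x) = p x ^ 2 + c) (hg1 : ∀ x, 1 ≤ g x) (hgK : ∀ x, g x ≤ K)
    (hexp : ∀ x, μ * g x ≤ ‖2 * p x‖ * g (τ x)) (hμ : 1 < μ - r * K) (hr : 0 ≤ r) {x y : X}
    (hxy : ∀ n, ‖p (τ^[n] x) - p (τ^[n] y)‖ ≤ r) : p x = p y := by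
  have hgrow : ∀ n, (μ - r * K) ^ n * ‖p x - p y‖
      ≤ g (τ^[n] x) * ‖p (τ^[n] x) - p (τ^[n] y)‖ := by
    intro n
    induction n with
    | zero => simpa using le_mul_of_one_le_left (norm_nonneg _) (hg1 x)
    | succ n ih =>
      have hx := hxy n
      rw [Function.iterate_succ_apply', Function.iterate_succ_apply']
      generalize τ^[n] x = x' at *
      generalize τ^[n] y = y' at *
      have h1 : p (τ x') - p (τ y') = (2 * p x' - (p x' - p y')) * (p x' - p y') := by
        rw [hpτ, hpτ]; ring
      have h2 : (μ - r * K) * g x' ≤ g (τ x') * ‖2 * p x' - (p x' - p y')‖ := by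
        have h3 := norm_sub_norm_le (2 * p x') (p x' - p y')
        have h4 : g (τ x') * (‖2 * p x'‖ - r) ≤ g (τ x') * ‖2 * p x' - (p x' - p y')‖ :=
          mul_le_mul_of_nonneg_left (by linarith) (by linarith [hg1 (τ x')])
        have h5 : r * g (τ x') ≤ r * K := mul_le_mul_of_nonneg_left (hgK _) hr
        have h6 : r * K ≤ r * K * g x' :=
          le_mul_of_one_le_right (mul_nonneg hr (by linarith [hg1 x', hgK x'])) (hg1 x')
        linarith [hexp x']
      rw [h1, norm_mul, pow_succ', mul_assoc, ← mul_assoc]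
      calc _ ≤ (μ - r * K) * (g x' * ‖p x' - p y'‖) := by
            rw [mul_assoc]; gcongr
        _ = (μ - r * K) * g x' * ‖p x' - p y'‖ := by ring
        _ ≤ _ := by
            rw [← mul_assoc]
            exact mul_le_mul_of_nonneg_right h2 (norm_nonneg _)
  by_contra hne
  have hpos : 0 < ‖p x - p y‖ := norm_pos_iff.2 (sub_ne_zero.2 hne)
  obtain ⟨n, hn⟩ := pow_unbounded_of_one_lt (K * r / ‖p x - p y‖) hμ
  rw [div_lt_iff₀ hpos] at hn
  have h1 : g (τ^[n] x) * ‖p (τ^[n] x) - p (τ^[n] y)‖ ≤ K * r :=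
    mul_le_mul (hgK _) (hxy n) (norm_nonneg _) (by linarith [hg1 x, hgK x])
  linarith [hgrow n]

theorem hasFDerivAt_henon (c b : ℂ) (p : ℂ × ℂ) :
    HasFDerivAt (henon c b) (((2 * p.1) • ContinuousLinearMap.fst ℂ ℂ ℂ
      - b • ContinuousLinearMap.snd ℂ ℂ ℂ).prod (ContinuousLinearMap.fst ℂ ℂ ℂ)) p := by
  have h1 : HasFDerivAt (fun x : ℂ × ℂ => x.1) (ContinuousLinearMap.fst ℂ ℂ ℂ) p := hasFDerivAt_fst
  have h2 : HasFDerivAt (fun x : ℂ × ℂ => x.2) (ContinuousLinearMap.snd ℂ ℂ ℂ) p := hasFDerivAt_snd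
  refine HasFDerivAt.prodMk ?_ h1
  exact (((h1.pow 2).add_const c).sub (h2.const_mul b)).congr_fderiv (by simp)

theorem hasFDerivAt_henonInv (c b : ℂ) (p : ℂ × ℂ) :
    HasFDerivAt (henonInv c b) ((ContinuousLinearMap.snd ℂ ℂ ℂ).prod
      (b⁻¹ • ((2 * p.2) • ContinuousLinearMap.snd ℂ ℂ ℂ - ContinuousLinearMap.fst ℂ ℂ ℂ))) p := by
  have h1 : HasFDerivAt (fun x : ℂ × ℂ => x.1) (ContinuousLinearMap.fst ℂ ℂ ℂ) p := hasFDerivAt_fst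
  have h2 : HasFDerivAt (fun x : ℂ × ℂ => x.2) (ContinuousLinearMap.snd ℂ ℂ ℂ) p := hasFDerivAt_snd
  refine HasFDerivAt.prodMk h2 ?_
  simp_rw [div_eq_inv_mul]
  exact ((((h2.pow 2).add_const c).sub h1).const_mul b⁻¹).congr_fderiv (by simp)

theorem fderiv_henon_apply (c b : ℂ) (p v : ℂ × ℂ) :
    fderiv ℂ (henon c b) p v = (2 * p.1 * v.1 - b * v.2, v.1) := by
  rw [(hasFDerivAt_henon c b p).fderiv]; simp

theorem fderiv_henonInv_apply (c b : ℂ) (p v : ℂ × ℂ) :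
    fderiv ℂ (henonInv c b) p v = (v.2, b⁻¹ * (2 * p.2 * v.2 - v.1)) := by
  rw [(hasFDerivAt_henonInv c b p).fderiv]; simp

theorem fderiv_iterate_succ_apply {E : Type*} [NormedAddCommGroup E] [NormedSpace ℂ E]
    {f : E → E} (hf : Differentiable ℂ f) (n : ℕ) (z v : E) :
    fderiv ℂ (f^[n + 1]) z v = fderiv ℂ (f^[n]) (f z) (fderiv ℂ f z v) := by
  rw [Function.iterate_succ, fderiv_comp z ((hf.iterate n) _) (hf z)]
  rfl

theorem isHyperbolicSet_range {X : Type*} [TopologicalSpace X] (τ : X ≃ₜ X)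
    {b c : ℂ} (hb : b ≠ 0) {Φ : X → ℂ × ℂ} (hΦ : IsEmbedding Φ)
    (hH : ∀ x, henon c b (Φ x) = Φ (τ x)) (hHinv : ∀ x, henonInv c b (Φ x) = Φ (τ.symm x))
    {k m : X → ℂ} (hkc : Continuous k) (hmc : Continuous m)
    (hk : ∀ x, k x * (2 * (Φ x).1 - b * k (τ x)) = 1)
    (hm : ∀ x, m x * (2 * (Φ x).2 - b * m (τ.symm x)) = 1)
    {g : X → ℝ} {ν K R : ℝ} (hg1 : ∀ x, 1 ≤ g x) (hgK : ∀ x, g x ≤ K) (hK : 0 < K) (hν : 1 < ν)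
    (hmg : ∀ x, ν * g (τ.symm x) * ‖m x‖ ≤ g x) (hmR : ∀ x, ‖m x‖ ≤ R) (hR : 1 ≤ R)
    (hbk : ∀ x, ‖b * k x‖ ≤ 1 / 2) (hbkm : ∀ x, ‖b * k x * m x‖ ≤ 1 / 2) :
    IsHyperbolicSet (henon c b) (henonInv c b) (range Φ) := by
  let k' := Function.extend Φ k 0
  let m' := Function.extend Φ m 0
  have hk' : ∀ x, k' (Φ x) = k x := hΦ.injective.extend_apply k 0
  have hm' : ∀ x, m' (Φ x) = m x := hΦ.injective.extend_apply m 0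
  have hkne : ∀ x, k x ≠ 0 := fun x => left_ne_zero_of_mul_eq_one (hk x)
  have hmne : ∀ x, m x ≠ 0 := fun x => left_ne_zero_of_mul_eq_one (hm x)
  have hden : ∀ x, 1 - b * k x * m x ≠ 0 := fun x h => by
    have h1 := hbkm x
    rw [← sub_eq_zero.1 h, norm_one] at h1
    norm_num at h1
  have hfs : ∀ x, fderiv ℂ (henon c b) (Φ x) (b * k x, 1) = (b * k x) • (b * k (τ x), 1) := by
    intro x
    rw [fderiv_henon_apply]
    ext
    · simp; linear_combination b * hk x
    · simp
  have hfu : ∀ x, fderiv ℂ (henon c b) (Φ x) (1, m x) = (m (τ x))⁻¹ • (1, m (τ x)) := by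
    intro x
    have h1 := hm (τ x)
    rw [← hH, τ.symm_apply_apply] at h1
    rw [fderiv_henon_apply, inv_eq_of_mul_eq_one_right h1]
    ext
    · simp [henon]
    · simp only [Prod.smul_mk, smul_eq_mul]
      rw [mul_comm]; exact h1.symm
  have hfu' : ∀ x, fderiv ℂ (henonInv c b) (Φ x) (1, m x) = m x • (1, m (τ.symm x)) := by
    intro x
    rw [fderiv_henonInv_apply]
    ext
    · simp
    · simp only [Prod.smul_mk, smul_eq_mul]
      rw [inv_mul_eq_iff_eq_mul₀ hb]
      linear_combination hm x
  have hfd : Differentiable ℂ (henon c b) := fun p => (hasFDerivAt_henon c b p).differentiableAt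
  have hid : Differentiable ℂ (henonInv c b) :=
    fun p => (hasFDerivAt_henonInv c b p).differentiableAt
  refine ⟨fun z => Submodule.span ℂ {(b * k' z, 1)}, fun z => Submodule.span ℂ {(1, m' z)},
    fun z => (1 - b * k' z * m' z)⁻¹ • (ContinuousLinearMap.snd ℂ ℂ ℂ
      - m' z • ContinuousLinearMap.fst ℂ ℂ ℂ).smulRight (b * k' z, (1 : ℂ)),
    1, R * K, 1 / 2, ν, one_pos, by positivity, by norm_num, by norm_num, hν, ?_, ?_, ?_, ?_, ?_,
    ?_, ?_, ?_⟩
  · rw [continuousOn_iff_continuous_domRestrict, ← hΦ.toHomeomorph.comp_continuous_iff']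
    have h1 : Continuous fun x => (1 - b * k x * m x)⁻¹ • (ContinuousLinearMap.snd ℂ ℂ ℂ
        - m x • ContinuousLinearMap.fst ℂ ℂ ℂ).smulRight (b * k x, (1 : ℂ)) := by
      have h2 : Continuous fun x => (1 - b * k x * m x)⁻¹ :=
        Continuous.inv₀ (by fun_prop) hden
      have h3 : Continuous fun x => ContinuousLinearMap.smulRightL ℂ (ℂ × ℂ) (ℂ × ℂ)
          (ContinuousLinearMap.snd ℂ ℂ ℂ - m x • ContinuousLinearMap.fst ℂ ℂ ℂ)
          (b * k x, (1 : ℂ)) := by fun_prop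
      exact h2.smul h3
    refine h1.congr fun x => ?_
    simp [hk', hm']
  · rintro _ ⟨x, rfl⟩ v
    simp only [hk', hm', Submodule.mem_span_singleton]
    refine ⟨⟨(1 - b * k x * m x)⁻¹ * (v.2 - m x * v.1), ?_⟩,
      ⟨v.1 - (1 - b * k x * m x)⁻¹ * (v.2 - m x * v.1) * (b * k x), ?_⟩⟩
    · simp [mul_assoc]
    · have := hden x
      ext
      · simp [mul_assoc]
      · simp
        field_simp
        ring
  · rintro _ ⟨x, rfl⟩ v hv
    simp only [hk', hm', Submodule.mem_span_singleton] at hv ⊢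
    obtain ⟨t, rfl⟩ := hv
    have := hden x
    ext <;> simp <;> field_simp
  · rintro _ ⟨x, rfl⟩ v hv
    simp only [hk', hm', Submodule.mem_span_singleton] at hv ⊢
    obtain ⟨t, rfl⟩ := hv
    ext <;> simp [mul_comm]
  · rintro _ ⟨x, rfl⟩
    simp only [hH, hk']
    rw [Submodule.map_span, image_singleton, ContinuousLinearMap.coe_coe, hfs]
    exact Submodule.span_singleton_smul_eq (mul_ne_zero hb (hkne x)).isUnit _
  · rintro _ ⟨x, rfl⟩
    simp only [hH, hm']
    rw [Submodule.map_span, image_singleton, ContinuousLinearMap.coe_coe, hfu]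
    exact Submodule.span_singleton_smul_eq (inv_ne_zero (hmne _)).isUnit _
  · have h1 : ∀ (n : ℕ) x (t : ℂ),
        ‖fderiv ℂ ((henon c b)^[n]) (Φ x) (t • (b * k x, 1))‖ ≤ (1 / 2) ^ n * ‖t‖ := by
      intro n
      induction n with
      | zero =>
        intro x t
        rw [Function.iterate_zero, fderiv_id, ContinuousLinearMap.id_apply, norm_smul,
          Prod.norm_mk, norm_one, max_eq_right (by linarith [hbk x])]
        simp
      | succ n ih =>
        intro x t
        rw [fderiv_iterate_succ_apply hfd, map_smul, hfs, hH, smul_smul]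
        refine (ih _ _).trans ?_
        rw [norm_mul, pow_succ, mul_assoc, mul_comm ‖t‖]
        gcongr
        exact hbk x
    rintro _ ⟨x, rfl⟩ n - v hv
    simp only [hk', Submodule.mem_span_singleton] at hv
    obtain ⟨t, rfl⟩ := hv
    refine (h1 n x t).trans ?_
    rw [one_mul, norm_smul]
    gcongr
    refine le_mul_of_one_le_right (norm_nonneg _) ?_
    simp
  · have h1 : ∀ (n : ℕ) x (t : ℂ),
        ‖fderiv ℂ ((henonInv c b)^[n]) (Φ x) (t • (1, m x))‖ ≤ R * g x * (ν ^ n)⁻¹ * ‖t‖ := by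
      intro n
      induction n with
      | zero =>
        intro x t
        rw [Function.iterate_zero, fderiv_id, ContinuousLinearMap.id_apply, norm_smul,
          Prod.norm_mk, norm_one, pow_zero, inv_one, mul_one, mul_comm]
        gcongr
        exact (max_le hR (hmR x)).trans (le_mul_of_one_le_right (by linarith) (hg1 x))
      | succ n ih =>
        intro x t
        rw [fderiv_iterate_succ_apply hid, map_smul, hfu', hHinv, smul_smul]
        refine (ih _ _).trans ?_
        have h2 : g (τ.symm x) * ‖m x‖ ≤ ν⁻¹ * g x := by
          rw [le_inv_mul_iff₀ (by linarith), ← mul_assoc]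
          exact hmg x
        rw [norm_mul, pow_succ, mul_inv]
        calc _ = R * (ν ^ n)⁻¹ * ‖t‖ * (g (τ.symm x) * ‖m x‖) := by ring
          _ ≤ R * (ν ^ n)⁻¹ * ‖t‖ * (ν⁻¹ * g x) := by gcongr
          _ = _ := by ring
    rintro _ ⟨x, rfl⟩ n - v hv
    simp only [hm', Submodule.mem_span_singleton] at hv
    obtain ⟨t, rfl⟩ := hv
    refine (h1 n x t).trans ?_
    rw [norm_smul]
    gcongr
    · exact hgK x
    · refine le_mul_of_one_le_right (norm_nonneg _) ?_
      simp

theorem exists_henon_conjugacy {X : Type*} [TopologicalSpace X] [CompactSpace X] (τ : X ≃ₜ X)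
    {p : X → ℂ} {g : X → ℝ} {b c : ℂ} {μ K B : ℝ} (hp : Continuous p) (hg : Continuous g)
    (hpτ : ∀ x, p (τ x) = p x ^ 2 + c) (hpB : ∀ x, ‖p x‖ ≤ B)
    (hμ : 1 < μ) (hg1 : ∀ x, 1 ≤ g x) (hgK : ∀ x, g x ≤ K)
    (hexp : ∀ x, μ * g x ≤ ‖2 * p x‖ * g (τ x))
    (hsep : ∀ x y, (∀ n : ℕ, p (τ.symm^[n] x) = p (τ.symm^[n] y)) → x = y)
    (hK : 1 ≤ K) (hB : 0 ≤ B) (hb0 : b ≠ 0)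
    (hb : ‖b‖ ≤ (1 - μ⁻¹) ^ 2 / (32 * K ^ 4 * (B + 1))) :
    ∃ Ab : Set (ℂ × ℂ), IsCompact Ab ∧ Invariant (henon c b) Ab ∧
      IsHyperbolicSet (henon c b) (henonInv c b) Ab ∧
      ∃ Φ : X ≃ₜ Ab, ∀ x, (Φ (τ x) : ℂ × ℂ) = henon c b (Φ x) := by
  obtain ⟨η, hη⟩ : ∃ η, η = 1 - μ⁻¹ := ⟨_, rfl⟩
  have hη0 : 0 < η := by linarith [inv_lt_one_of_one_lt₀ hμ]
  have hη1 : η < 1 := by linarith [inv_pos.2 (zero_lt_one.trans hμ)]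
  have hημ : 1 + η ≤ μ := by
    have h1 : μ * μ⁻¹ = 1 := mul_inv_cancel₀ (by linarith)
    have h2 : 0 < (μ - 1) * η := mul_pos (by linarith) hη0
    rw [hη] at h2 ⊢
    nlinarith
  obtain ⟨r, hr⟩ : ∃ r, r = η / (8 * K ^ 2) := ⟨_, rfl⟩
  have hr0 : 0 < r := hr ▸ by positivity
  have hrK2 : K ^ 2 * r = η / 8 := by rw [hr]; field_simp
  have hKK : K ≤ K ^ 2 := by nlinarith
  have hrK : r * K ≤ η / 8 := by nlinarith
  have hr1 : r ≤ 1 := by nlinarith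
  have hbB : K ^ 2 * (‖b‖ * (B + 1)) ≤ η * r / 4 := by
    rw [← hη, le_div_iff₀ (by positivity)] at hb
    rw [hr, mul_div_assoc', div_div, le_div_iff₀ (by positivity)]
    linarith
  have hbK : K ^ 2 * ‖b‖ ≤ η / 32 := by
    have h1 : K ^ 2 * ‖b‖ ≤ K ^ 2 * (‖b‖ * (B + 1)) := by
      gcongr
      exact le_mul_of_one_le_right (norm_nonneg _) (by linarith)
    have h2 : r ≤ K ^ 2 * r := by nlinarith
    nlinarith
  have hb' : K * ‖b‖ ≤ η / 32 := le_trans (by gcongr) hbK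
  obtain ⟨h, hh, hhr, hrec⟩ := exists_shadowing τ hp hg hpτ hpB hμ hg1 hgK hexp hr0.le (b := b)
    (by
      have h1 : ‖b‖ * (B + r) ≤ ‖b‖ * (B + 1) := by gcongr
      have h2 : K ^ 2 * (‖b‖ * (B + r)) ≤ K ^ 2 * (‖b‖ * (B + 1)) := by gcongr
      have h3 : μ⁻¹ * r = r - η * r := by rw [hη]; ring
      have h4 : K ^ 2 * r ^ 2 = η * r / 8 := by rw [sq r, ← mul_assoc, hrK2]; ring
      nlinarith [mul_pos hη0 hr0])
    (by linarith)
  have hp1 : ∀ x, 1 ≤ ‖2 * p x‖ * K := fun x => by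
    have h1 : ‖2 * p x‖ * g (τ x) ≤ ‖2 * p x‖ * K := by gcongr; exact hgK _
    nlinarith [hexp x, hg1 x]
  have hh2 : ∀ x, ‖2 * p x‖ - 2 * r ≤ ‖2 * h x‖ := fun x => by
    have h1 := norm_sub_norm_le (2 * p x) (2 * p x - 2 * h x)
    have h2 : ‖2 * p x - 2 * h x‖ ≤ 2 * r := by
      rw [← mul_sub, norm_mul, norm_sub_rev, Complex.norm_ofNat]
      gcongr
      exact hhr x
    rw [_root_.sub_sub_cancel] at h1
    linarith
  have hK0 : 0 < K := by linarith
  have hδ : ∀ x, 2 * (4 * K)⁻¹ ≤ ‖2 * h x‖ := fun x => by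
    have h1 : 2 * (4 * K)⁻¹ = (1 / 2) / K := by field_simp; norm_num
    rw [h1, div_le_iff₀ hK0]
    nlinarith [hh2 x, hp1 x]
  have hbδ : ‖b‖ ≤ (4 * K)⁻¹ ^ 2 / 2 := by
    have h1 : (4 * K)⁻¹ ^ 2 / 2 = (1 / 32) / K ^ 2 := by field_simp; norm_num
    rw [h1, le_div_iff₀ (by positivity)]
    linarith
  have hδ0 : 0 < (4 * K)⁻¹ := by positivity
  obtain ⟨k, hkc, hkK, hk⟩ := exists_continuous_slope τ.continuous
    (by fun_prop : Continuous fun x => 2 * h x) hδ0 hδ hbδ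
  obtain ⟨m, hmc, hmK, hm⟩ := exists_continuous_slope τ.symm.continuous
    (by fun_prop : Continuous fun x => 2 * h (τ.symm x)) hδ0 (fun x => hδ _) hbδ
  rw [inv_inv] at hkK hmK
  let Φ : X → ℂ × ℂ := fun x => (h x, h (τ.symm x))
  have hΦc : Continuous Φ := by fun_prop
  have hH : ∀ x, henon c b (Φ x) = Φ (τ x) := fun x => by
    simp only [henon, Φ, hrec, τ.symm_apply_apply]
  have hHinv : ∀ x, henonInv c b (Φ x) = Φ (τ.symm x) := fun x => by
    have h1 := hrec (τ.symm x)
    rw [τ.apply_symm_apply] at h1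
    simp only [henonInv, Φ, Prod.mk.injEq, true_and]
    rw [div_eq_iff hb0, h1]
    ring
  have hpΦ : ∀ x y, Φ x = Φ y → p x = p y := by
    intro x y hxy
    have h1 : ∀ n, Φ (τ^[n] x) = Φ (τ^[n] y) := by
      intro n
      induction n with
      | zero => exact hxy
      | succ n ih => rw [Function.iterate_succ_apply', Function.iterate_succ_apply', ← hH, ih, hH]
    refine eq_of_forall_norm_sub_le hpτ hg1 hgK hexp (r := 2 * r) (by linarith) (by linarith)
      fun n => ?_
    have h2 : h (τ^[n] x) = h (τ^[n] y) := congrArg Prod.fst (h1 n)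
    have h3 := norm_sub_le (h (τ^[n] y) - p (τ^[n] y)) (h (τ^[n] x) - p (τ^[n] x))
    have h4 := hhr (τ^[n] x)
    rw [h2] at h3 h4
    rw [_root_.sub_sub_sub_cancel_left] at h3
    linarith [hhr (τ^[n] y)]
  have hΦi : Function.Injective Φ := by
    intro x y hxy
    refine hsep x y fun n => hpΦ _ _ ?_
    induction n with
    | zero => exact hxy
    | succ n ih =>
      rw [Function.iterate_succ_apply', Function.iterate_succ_apply', ← hHinv, ih, hHinv]
  have hΦ : IsEmbedding Φ := (hΦc.isClosedEmbedding hΦi).isEmbedding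
  refine ⟨range Φ, isCompact_range hΦc, ?_, ?_, hΦ.toHomeomorph, fun x => (hH x).symm⟩
  · ext z
    constructor
    · rintro ⟨x, hx⟩
      refine ⟨τ.symm x, ?_⟩
      rw [← hHinv, hx]
      simp only [henon, henonInv, Prod.ext_iff, true_and]
      field_simp
      ring
    · rintro ⟨x, rfl⟩
      exact ⟨τ x, (hH x).symm⟩
  · refine isHyperbolicSet_range τ hb0 hΦ hH hHinv hkc hmc hk hm hg1 hgK hK0 (ν := 1 + η / 2)
      (by linarith) (fun x => ?_) hmK (by linarith) (fun x => ?_) (fun x => ?_)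
    · have h1 : ‖m x‖ * ‖2 * h (τ.symm x) - b * m (τ.symm x)‖ = 1 := by
        rw [← norm_mul, hm, norm_one]
      have h2 := norm_sub_norm_le (2 * h (τ.symm x)) (b * m (τ.symm x))
      have h3 : ‖b * m (τ.symm x)‖ ≤ ‖b‖ * (4 * K) := by
        rw [norm_mul]; gcongr; exact hmK _
      have h4 := hh2 (τ.symm x)
      have h5 := hexp (τ.symm x)
      rw [τ.apply_symm_apply] at h5
      have h6 : (1 + η / 2) * g (τ.symm x)
          ≤ g x * ‖2 * h (τ.symm x) - b * m (τ.symm x)‖ := by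
        have h7 : g x * (‖2 * p (τ.symm x)‖ - (2 * r + ‖b‖ * (4 * K)))
            ≤ g x * ‖2 * h (τ.symm x) - b * m (τ.symm x)‖ :=
          mul_le_mul_of_nonneg_left (by linarith) (by linarith [hg1 x])
        have h8 : g x * (2 * r + ‖b‖ * (4 * K)) ≤ K * (2 * r + ‖b‖ * (4 * K)) := by
          gcongr; exact hgK x
        have h9 : (1 + η) * g (τ.symm x) ≤ μ * g (τ.symm x) :=
          mul_le_mul_of_nonneg_right hημ (by linarith [hg1 (τ.symm x)])
        nlinarith [hg1 (τ.symm x)]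
      calc _ ≤ g x * ‖2 * h (τ.symm x) - b * m (τ.symm x)‖ * ‖m x‖ := by gcongr
        _ = g x * (‖m x‖ * ‖2 * h (τ.symm x) - b * m (τ.symm x)‖) := by ring
        _ = g x := by rw [h1, mul_one]
    · rw [norm_mul]
      calc _ ≤ ‖b‖ * (4 * K) := by gcongr; exact hkK x
        _ ≤ _ := by linarith
    · rw [norm_mul, norm_mul]
      calc _ ≤ ‖b‖ * (4 * K) * (4 * K) := by gcongr; exacts [hkK x, hmK x]
        _ ≤ _ := by linarith

theorem fst_eq_of_mem_image_gmap {c : ℂ} {Λ : Set ℂ} {w : ℂ × ℂ} (hw : w ∈ gmap c '' Λ) :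
    w.2 ∈ Λ ∧ w.1 = qmap c w.2 := by
  obtain ⟨x, hx, rfl⟩ := hw
  exact ⟨hx, rfl⟩

theorem continuous_henon (c b : ℂ) : Continuous (henon c b) := by
  unfold henon; fun_prop

theorem compactSpace_sigmaSet {Y : Type*} [TopologicalSpace Y] [T2Space Y] {f : Y → Y}
    (hf : Continuous f) {S : Set Y} (hS : IsCompact S) : CompactSpace (SigmaSet f S) := by
  refine isCompact_iff_compactSpace.1 ?_
  have h1 : SigmaSet f S = univ.pi (fun _ => S) ∩ ⋂ i, {z : ℤ → Y | f (z i) = z (i + 1)} := by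
    ext z; simp [SigmaSet, Set.mem_pi]
  rw [h1]
  exact (isCompact_univ_pi fun _ => hS).inter_right
    (isClosed_iInter fun i => isClosed_eq (by fun_prop) (by fun_prop))

/-- The shift as a self-homeomorphism of `Σ(S, f)`. -/
def sigmaShiftHomeomorph {Y : Type*} [TopologicalSpace Y] (f : Y → Y) (S : Set Y) :
    SigmaSet f S ≃ₜ SigmaSet f S where
  toFun := sigmaShift f S
  invFun z := ⟨fun i => z.1 (i - 1), fun i => z.2.1 _, fun i => by
    simp [z.2.2]⟩
  left_inv z := by
    ext i
    simp [sigmaShift, shiftSeq]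
  right_inv z := by
    ext i
    simp [sigmaShift, shiftSeq]
  continuous_toFun := by
    refine Continuous.subtype_mk (continuous_pi fun i => ?_) _
    exact (continuous_apply (i + 1)).comp continuous_subtype_val
  continuous_invFun := by
    refine Continuous.subtype_mk (continuous_pi fun i => ?_) _
    exact (continuous_apply (i - 1)).comp continuous_subtype_val

theorem sigmaShiftHomeomorph_symm_iterate {Y : Type*} [TopologicalSpace Y] {f : Y → Y} {S : Set Y}
    (z : SigmaSet f S) (n : ℕ) (i : ℤ) :
    ((sigmaShiftHomeomorph f S).symm^[n] z).1 i = z.1 (i - n) := by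
  induction n generalizing i with
  | zero => simp
  | succ n ih =>
    rw [Function.iterate_succ_apply']
    change ((sigmaShiftHomeomorph f S).symm^[n] z).1 (i - 1) = _
    rw [ih, Nat.cast_succ, sub_sub, add_comm (1 : ℤ)]

/-- If `Λ ⊆ ℂ` is a compact `q`-invariant set on which `q` is uniformly expanding
and `A = g(Λ)`, then there is `ε₀ > 0` such that for `0 < |b| < ε₀` there are a
compact `H_b`-invariant uniformly hyperbolic set `A_b ⊆ ℂ²` and a homeomorphism
`Φ_b : Σ(A, H₀) → A_b` with `Φ_b ∘ σ = H_b ∘ Φ_b`. -/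
theorem shadowing_conjugacy (c : ℂ) (Λ : Set ℂ) (hcomp : IsCompact Λ)
    (hinv : Invariant (qmap c) Λ) (hexp : IsExpandingOn (qmap c) Λ) :
    ∃ ε₀ > 0, ∀ b : ℂ, b ≠ 0 → ‖b‖ < ε₀ →
      ∃ Ab : Set (ℂ × ℂ), IsCompact Ab ∧ Invariant (henon c b) Ab ∧
        IsHyperbolicSet (henon c b) (henonInv c b) Ab ∧
        ∃ h : (SigmaSet (henon c 0) (gmap c '' Λ)) ≃ₜ Ab,
          ∀ z : SigmaSet (henon c 0) (gmap c '' Λ),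
            (h (sigmaShift (henon c 0) (gmap c '' Λ) z) : ℂ × ℂ) = henon c b (h z) := by
  obtain ⟨ρ, μ, K, hρ, hμ, hρ1, hρK, hρexp⟩ := exists_weight_of_isExpandingOn hcomp hexp
  obtain ⟨B, hB⟩ := hcomp.exists_bound_of_continuousOn continuousOn_id
  have hη : 0 < 1 - μ⁻¹ := sub_pos.2 (inv_lt_one_of_one_lt₀ hμ)
  have hK : 0 < max K 1 := lt_max_of_lt_right one_pos
  have hB0 : 0 ≤ max B 0 := le_max_right _ _
  refine ⟨(1 - μ⁻¹) ^ 2 / (32 * max K 1 ^ 4 * (max B 0 + 1)), by positivity, fun b hb0 hb => ?_⟩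
  have hgc : Continuous (gmap c) := by unfold gmap qmap; fun_prop
  have : CompactSpace (SigmaSet (henon c 0) (gmap c '' Λ)) :=
    compactSpace_sigmaSet (continuous_henon c 0) (hcomp.image hgc)
  have hmem : ∀ (z : SigmaSet (henon c 0) (gmap c '' Λ)) i,
      (z.1 i).2 ∈ Λ ∧ (z.1 i).1 = qmap c (z.1 i).2 := fun z i => fst_eq_of_mem_image_gmap (z.2.1 i)
  have hp : Continuous fun z : SigmaSet (henon c 0) (gmap c '' Λ) => (z.1 0).2 :=
    continuous_snd.comp ((continuous_apply 0).comp continuous_subtype_val)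
  have hpτ : ∀ z : SigmaSet (henon c 0) (gmap c '' Λ), (z.1 (0 + 1)).2 = qmap c (z.1 0).2 :=
    fun z => by rw [← z.2.2, ← (hmem z 0).2]; rfl
  refine exists_henon_conjugacy (sigmaShiftHomeomorph (henon c 0) (gmap c '' Λ)) hp
    (hρ.comp hp) hpτ (fun z => (hB _ (hmem z 0).1).trans (le_max_left _ _)) hμ (fun z => hρ1 _)
    (fun z => (hρK _ (hmem z 0).1).trans (le_max_left _ _)) (fun z => ?_) (fun z z' h => ?_)
    (le_max_right _ _) hB0 hb0 hb.le
  · refine (hρexp _ (hmem z 0).1).trans_eq ?_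
    rw [← hpτ z]
    rfl
  · simp only [sigmaShiftHomeomorph_symm_iterate, zero_sub] at h
    have hneg : ∀ n : ℕ, z.1 (-n) = z'.1 (-n) := fun n =>
      Prod.ext (by rw [(hmem z _).2, (hmem z' _).2, h n]) (h n)
    have hpos : ∀ n : ℕ, z.1 n = z'.1 n := by
      intro n
      induction n with
      | zero => simpa using hneg 0
      | succ n ih => rw [Nat.cast_succ, ← z.2.2, ← z'.2.2, ih]
    ext1
    funext i
    obtain ⟨n, rfl | rfl⟩ := i.eq_nat_or_neg
    · exact hpos n
    · exact hneg n
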